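/- arXiv:1109.3142 — 4 statements merged into one kernel-verified Lean document; each statement's English description precedes it below -/
import Mathlib

section
/- Let X and Θ be finite nonempty types, let p be a probability mass function on X × Θ, and fix b : X with marginal p_X(b) := Σ_θ p(b,θ) > 0. Define q*(x,θ) := if x = b then p(b,θ)/p_X(b) else 0 (the Bayes posterior concentrated on x = b). Then q* is a probability mass function on X × Θ whose X-marginal is the point mass at b, KL(q*‖p) = −log p_X(b), and for every probability mass function q on X × Θ whose X-marginal is the point mass at b one has KL(q‖p) ≥ KL(q*‖p), with equality (when KL(q‖p) is finite) if and only if q = q*. In particular, Bayes' rule is the unique solution of constrained minimisation of Kullback–Leibler relative entropy under the constraint that the X-marginal equals the point mass at the observed datum b. -/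
open scoped BigOperators Classical

/-- A probability mass function on a finite type: nonnegative and summing to 1. -/
def IsPMF {α : Type*} [Fintype α] (p : α → ℝ) : Prop :=
  (∀ a, 0 ≤ p a) ∧ ∑ a, p a = 1

/-- Kullback–Leibler divergence with the conventions `0 · log (0 / q x) = 0` and
`KL(p‖q) = +∞` if `p x > 0` for some `x` with `q x = 0`. -/
noncomputable def KL {α : Type*} [Fintype α] (p q : α → ℝ) : EReal :=
  if ∀ a, 0 < p a → 0 < q a then ((∑ a, p a * Real.log (p a / q a) : ℝ) : EReal) else ⊤

theorem sub_lt_mul_log_div {x y : ℝ} (hx : 0 ≤ x) (hy : 0 ≤ y) (hxy : 0 < x → 0 < y)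
    (hne : x ≠ y) : x - y < x * Real.log (x / y) := by
  rcases hx.eq_or_lt with rfl | hx
  · simpa using lt_of_le_of_ne hy hne
  · have hy := hxy hx
    have h := Real.log_lt_sub_one_of_pos (div_pos hy hx)
      (fun h => hne ((div_eq_one_iff_eq hx.ne').1 h).symm)
    rw [← inv_div y x, Real.log_inv]
    have h' := mul_lt_mul_of_pos_left h hx
    have e : x * (y / x - 1) = y - x := by field_simp
    linarith

theorem sub_le_mul_log_div {x y : ℝ} (hx : 0 ≤ x) (hy : 0 ≤ y) (hxy : 0 < x → 0 < y) :
    x - y ≤ x * Real.log (x / y) := by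
  by_cases h : x = y
  · subst h
    rcases hx.eq_or_lt with rfl | hx
    · simp
    · simp [hx.ne']
  · exact (sub_lt_mul_log_div hx hy hxy h).le

/-- Gibbs' inequality. -/
theorem IsPMF.sum_mul_log_div_nonneg {α : Type*} [Fintype α] {q r : α → ℝ}
    (hq : IsPMF q) (hr : IsPMF r) (hqr : ∀ a, 0 < q a → 0 < r a) :
    0 ≤ ∑ a, q a * Real.log (q a / r a) := by
  calc (0 : ℝ) = ∑ a, (q a - r a) := by rw [Finset.sum_sub_distrib, hq.2, hr.2, sub_self]
    _ ≤ _ := Finset.sum_le_sum fun a _ => sub_le_mul_log_div (hq.1 a) (hr.1 a) (hqr a)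

/-- The equality case of Gibbs' inequality. -/
theorem IsPMF.sum_mul_log_div_eq_zero_iff {α : Type*} [Fintype α] {q r : α → ℝ}
    (hq : IsPMF q) (hr : IsPMF r) (hqr : ∀ a, 0 < q a → 0 < r a) :
    ∑ a, q a * Real.log (q a / r a) = 0 ↔ q = r := by
  constructor
  · intro h
    by_contra hne
    obtain ⟨a, ha⟩ := Function.ne_iff.1 hne
    have hlt : ∑ a, (q a - r a) < ∑ a, q a * Real.log (q a / r a) :=
      Finset.sum_lt_sum (fun a _ => sub_le_mul_log_div (hq.1 a) (hr.1 a) (hqr a))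
        ⟨a, Finset.mem_univ a, sub_lt_mul_log_div (hq.1 a) (hr.1 a) (hqr a) ha⟩
    rw [Finset.sum_sub_distrib, hq.2, hr.2, sub_self, h] at hlt
    exact hlt.false
  · rintro rfl
    refine Finset.sum_eq_zero fun a _ => ?_
    by_cases ha : q a = 0 <;> simp [ha]

/-- If `r` agrees with `p / Z` on the support of `q`, then the relative entropies of `q`
with respect to `p` and to `r` differ by `log Z`. -/
theorem IsPMF.sum_mul_log_div_eq_sub_log {α : Type*} [Fintype α] {q p r : α → ℝ} {Z : ℝ}
    (hq : IsPMF q) (hZ : 0 < Z) (hqp : ∀ a, 0 < q a → 0 < p a)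
    (hr : ∀ a, 0 < q a → r a = p a / Z) :
    ∑ a, q a * Real.log (q a / p a) = ∑ a, q a * Real.log (q a / r a) - Real.log Z := by
  calc ∑ a, q a * Real.log (q a / p a)
      = ∑ a, (q a * Real.log (q a / r a) - q a * Real.log Z) := by
        refine Finset.sum_congr rfl fun a _ => ?_
        rcases (hq.1 a).eq_or_lt with ha | ha
        · simp [← ha]
        · have hpa := hqp a ha
          rw [hr a ha, show q a / (p a / Z) = q a / p a * Z by field_simp,
            Real.log_mul (div_pos ha hpa).ne' hZ.ne']
          ring
    _ = _ := by rw [Finset.sum_sub_distrib, ← Finset.sum_mul, hq.2, one_mul]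

theorem bayes_rule_as_constrained_KL_minimisation
    (X Θ : Type*) [Fintype X] [Fintype Θ] [Nonempty X] [Nonempty Θ]
    (p : X × Θ → ℝ) (hp : IsPMF p) (b : X)
    (hb : 0 < ∑ θ, p (b, θ))
    (qstar : X × Θ → ℝ)
    (hqstar : qstar = fun z => if z.1 = b then p (b, z.2) / (∑ θ, p (b, θ)) else 0) :
    -- q* is a probability mass function
    IsPMF qstar ∧
    -- whose X-marginal is the point mass at b
    (fun x => ∑ θ, qstar (x, θ)) = (fun x => if x = b then (1 : ℝ) else 0) ∧
    -- KL(q*‖p) = − log p_X(b)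
    KL qstar p = ((- Real.log (∑ θ, p (b, θ)) : ℝ) : EReal) ∧
    -- q* is the unique minimiser of KL(·‖p) among pmfs with X-marginal the point mass at b
    (∀ q : X × Θ → ℝ, IsPMF q →
      (fun x => ∑ θ, q (x, θ)) = (fun x => if x = b then (1 : ℝ) else 0) →
      KL qstar p ≤ KL q p ∧
        (KL q p ≠ ⊤ → (KL q p = KL qstar p ↔ q = qstar))) := by
  set Z := ∑ θ, p (b, θ) with hZ
  have marg : (fun x => ∑ θ, qstar (x, θ)) = (fun x => if x = b then (1 : ℝ) else 0) := by
    funext x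
    by_cases hx : x = b
    · subst hx
      simp only [hqstar, if_true]
      rw [← Finset.sum_div, div_self hb.ne']
    · simp [hqstar, hx]
  have pmf : IsPMF qstar := by
    refine ⟨fun z => ?_, ?_⟩
    · rw [hqstar]
      dsimp only
      split_ifs
      · exact div_nonneg (hp.1 _) hb.le
      · exact le_rfl
    · rw [Fintype.sum_prod_type]
      simp [fun x => congrFun marg x]
  have qstar_of_fst : ∀ z : X × Θ, z.1 = b → qstar z = p z / Z := by
    rintro ⟨x, θ⟩ rfl
    simp [hqstar]
  have fst_of_pos : ∀ q : X × Θ → ℝ, IsPMF q →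
      (fun x => ∑ θ, q (x, θ)) = (fun x => if x = b then (1 : ℝ) else 0) →
      ∀ z, 0 < q z → z.1 = b := by
    rintro q hq hm ⟨x, θ⟩ hz
    by_contra hx
    have h0 : ∑ θ, q (x, θ) = 0 := (congrFun hm x).trans (if_neg hx)
    exact hz.ne' ((Finset.sum_eq_zero_iff_of_nonneg fun θ _ => hq.1 (x, θ)).1 h0 θ
      (Finset.mem_univ θ))
  have KL_eq : ∀ q : X × Θ → ℝ, IsPMF q →
      (fun x => ∑ θ, q (x, θ)) = (fun x => if x = b then (1 : ℝ) else 0) →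
      (∀ z, 0 < q z → 0 < p z) →
      KL q p = ((∑ z, q z * Real.log (q z / qstar z) - Real.log Z : ℝ) : EReal) := by
    intro q hq hm hqp
    rw [KL, if_pos hqp, hq.sum_mul_log_div_eq_sub_log hb hqp
      fun z hz => qstar_of_fst z (fst_of_pos q hq hm z hz)]
  have qstar_ac : ∀ z, 0 < qstar z → 0 < p z := by
    intro z hz
    rw [qstar_of_fst z (fst_of_pos qstar pmf marg z hz)] at hz
    exact (div_pos_iff_of_pos_right hb).1 hz
  have KL_qstar : KL qstar p = ((- Real.log Z : ℝ) : EReal) := by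
    rw [KL_eq qstar pmf marg qstar_ac,
      (pmf.sum_mul_log_div_eq_zero_iff pmf fun _ h => h).2 rfl, zero_sub]
  refine ⟨pmf, marg, KL_qstar, fun q hq hm => ?_⟩
  by_cases hqp : ∀ z, 0 < q z → 0 < p z
  · have hac : ∀ z, 0 < q z → 0 < qstar z := fun z hz => by
      rw [qstar_of_fst z (fst_of_pos q hq hm z hz)]
      exact div_pos (hqp z hz) hb
    rw [KL_qstar, KL_eq q hq hm hqp, EReal.coe_le_coe_iff, EReal.coe_eq_coe_iff,
      ← hq.sum_mul_log_div_eq_zero_iff pmf hac]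
    have := hq.sum_mul_log_div_nonneg pmf hac
    exact ⟨by linarith, fun _ => ⟨fun h => by linarith, fun h => by linarith⟩⟩
  · have htop : KL q p = ⊤ := if_neg hqp
    exact ⟨htop ▸ le_top, fun h => absurd htop h⟩
end

section
/- Let X be a finite nonempty type, let p be a probability mass function on X with p(x) > 0 for all x, and let C be a nonempty closed convex subset of the simplex of probability mass functions on X. Then there exists a unique q* ∈ C minimising KL(·‖p) over C, i.e. KL(q*‖p) ≤ KL(q‖p) for all q ∈ C, and any q ∈ C attaining this minimum equals q*. (Well-posedness of the constrained relative-entropic updating principle: the inference problem defined by a closed convex constraint set is neither overdetermined nor undetermined.) -/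
open scoped BigOperators

/-- A separable sum of strictly convex functions is strictly convex on the product set. -/
theorem StrictConvexOn.sum_apply {ι : Type*} [Fintype ι] {s : ι → Set ℝ} {f : ι → ℝ → ℝ}
    (hf : ∀ i, StrictConvexOn ℝ (s i) (f i)) :
    StrictConvexOn ℝ (Set.univ.pi s) fun q : ι → ℝ => ∑ i, f i (q i) := by
  refine ⟨convex_pi fun i _ => (hf i).1, fun x hx y hy hxy a b ha hb hab => ?_⟩
  obtain ⟨i, hi⟩ := Function.ne_iff.mp hxy
  simp only [smul_eq_mul, Finset.mul_sum, ← Finset.sum_add_distrib]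
  refine Finset.sum_lt_sum (fun j _ => ?_) ⟨i, Finset.mem_univ i, ?_⟩
  · exact (hf j).convexOn.2 (hx j trivial) (hy j trivial) ha.le hb.le hab
  · exact (hf i).2 (hx i trivial) (hy i trivial) hi ha hb hab

theorem mul_log_div_eq {c : ℝ} (hc : 0 < c) (t : ℝ) :
    t * Real.log (t / c) = t * Real.log t + -Real.log c * t := by
  rcases eq_or_ne t 0 with rfl | ht
  · simp
  · rw [Real.log_div ht hc.ne']
    ring

theorem continuous_mul_log_div {c : ℝ} (hc : 0 < c) :
    Continuous fun t : ℝ => t * Real.log (t / c) := by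
  simp only [mul_log_div_eq hc]
  exact Real.continuous_mul_log.add (continuous_const.mul continuous_id)

theorem strictConvexOn_mul_log_div {c : ℝ} (hc : 0 < c) :
    StrictConvexOn ℝ (Set.Ici 0) fun t : ℝ => t * Real.log (t / c) := by
  simp only [mul_log_div_eq hc]
  exact Real.strictConvexOn_mul_log.add_convexOn
    ((LinearMap.mul ℝ ℝ (-Real.log c)).convexOn (convex_Ici 0))

theorem KL_eq_coe_sum {α : Type*} [Fintype α] {p : α → ℝ} (hp : ∀ a, 0 < p a) (q : α → ℝ) :
    KL q p = ((∑ a, q a * Real.log (q a / p a) : ℝ) : EReal) :=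
  if_pos fun a _ => hp a

/-- Well-posedness of constrained relative-entropic updating: over a nonempty closed convex
constraint set `C` inside the simplex, `KL(·‖p)` has a unique minimiser (the inference
problem is neither overdetermined nor undetermined). -/
theorem KL_projection_exists_unique
    (X : Type*) [Fintype X] [Nonempty X]
    (p : X → ℝ) (hp : IsPMF p) (hppos : ∀ x, 0 < p x)
    (C : Set (X → ℝ)) (hCne : C.Nonempty) (hCclosed : IsClosed C)
    (hCconv : Convex ℝ C) (hCsub : C ⊆ {r : X → ℝ | IsPMF r}) :
    ∃ qstar : X → ℝ, qstar ∈ C ∧ (∀ q ∈ C, KL qstar p ≤ KL q p) ∧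
      ∀ q ∈ C, (∀ r ∈ C, KL q p ≤ KL r p) → q = qstar := by
  simp only [KL_eq_coe_sum hppos, EReal.coe_le_coe_iff]
  have hcont : Continuous fun q : X → ℝ => ∑ x, q x * Real.log (q x / p x) :=
    continuous_finsetSum _ fun x _ => (continuous_mul_log_div (hppos x)).comp (continuous_apply x)
  have hconv : StrictConvexOn ℝ C fun q : X → ℝ => ∑ x, q x * Real.log (q x / p x) :=
    (StrictConvexOn.sum_apply fun x => strictConvexOn_mul_log_div (hppos x)).subset
      (fun q hq x _ => (hCsub hq).1 x) hCconv
  have hcompact : IsCompact C := (isCompact_stdSimplex ℝ X).of_isClosed_subset hCclosed hCsub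
  obtain ⟨qstar, hmem, hmin⟩ := hcompact.exists_isMinOn hCne hcont.continuousOn
  exact ⟨qstar, hmem, fun q hq => hmin hq, fun q hq hqmin =>
    hconv.eq_of_isMinOn (fun r hr => hqmin r hr) hmin hq hmem⟩
end

section
/- Let X be a finite nonempty type, let p be a probability mass function on X with p(x) > 0 for all x, let C be a nonempty closed convex subset of the simplex of probability mass functions on X, and let q* ∈ C be a minimiser of KL(·‖p) over C with KL(q*‖p) finite. Then the Pythagorean inequality for the entropic projection holds: for every q ∈ C, KL(q‖p) ≥ KL(q‖q*) + KL(q*‖p). -/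
open scoped BigOperators

theorem KL_eq_coe_of_pos {X : Type*} [Fintype X] {p : X → ℝ} (hp : ∀ x, 0 < p x) (q : X → ℝ) :
    KL q p = ((∑ x, q x * Real.log (q x / p x) : ℝ) : EReal) :=
  if_pos fun x _ => hp x

/-- Gibbs' inequality, stated relative to a positive reference `p`. -/
theorem sum_mul_log_div_le {X : Type*} [Fintype X] {p r s : X → ℝ} (hp : ∀ x, 0 < p x)
    (hr : IsPMF r) (hs : IsPMF s) (hrs : ∀ x, 0 < s x → 0 < r x) :
    ∑ x, s x * Real.log (r x / p x) ≤ ∑ x, s x * Real.log (s x / p x) := by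
  have key : ∀ x, s x * Real.log (r x / p x) ≤ s x * Real.log (s x / p x) + (r x - s x) := by
    intro x
    rcases (hs.1 x).eq_or_lt with h | h
    · simpa [← h] using hr.1 x
    · have hrx := hrs x h
      have h1 := Real.log_le_sub_one_of_pos (div_pos hrx h)
      rw [Real.log_div hrx.ne' h.ne'] at h1
      rw [Real.log_div hrx.ne' (hp x).ne', Real.log_div h.ne' (hp x).ne']
      have h2 := mul_le_mul_of_nonneg_left h1 h.le
      have h3 : s x * (r x / s x - 1) = r x - s x := by field_simp
      linarith
  calc ∑ x, s x * Real.log (r x / p x)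
      ≤ ∑ x, (s x * Real.log (s x / p x) + (r x - s x)) := Finset.sum_le_sum fun x _ => key x
    _ = ∑ x, s x * Real.log (s x / p x) := by
      rw [Finset.sum_add_distrib, Finset.sum_sub_distrib, hr.2, hs.2]; ring

/-- If the relative entropy at `s` does not exceed its value at a point of the segment from `s`
to `q`, then it is bounded by the `q`-average of the log-density of that point. -/
theorem sum_mul_log_div_le_of_le_segment {X : Type*} [Fintype X] {p q s : X → ℝ}
    (hp : ∀ x, 0 < p x) (hq : IsPMF q) (hs : IsPMF s) {t : ℝ} (ht0 : 0 < t) (ht1 : t < 1)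
    (hmin : ∑ x, s x * Real.log (s x / p x) ≤
      ∑ x, ((1 - t) * s x + t * q x) * Real.log (((1 - t) * s x + t * q x) / p x)) :
    ∑ x, s x * Real.log (s x / p x) ≤
      ∑ x, q x * Real.log (((1 - t) * s x + t * q x) / p x) := by
  have ht1' : 0 < 1 - t := sub_pos.2 ht1
  have hr : IsPMF fun x => (1 - t) * s x + t * q x := by
    refine ⟨fun x => add_nonneg (mul_nonneg ht1'.le (hs.1 x)) (mul_nonneg ht0.le (hq.1 x)), ?_⟩
    rw [Finset.sum_add_distrib, ← Finset.mul_sum, ← Finset.mul_sum, hs.2, hq.2]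
    ring
  have hgibbs := sum_mul_log_div_le hp hr hs fun x hx =>
    add_pos_of_pos_of_nonneg (mul_pos ht1' hx) (mul_nonneg ht0.le (hq.1 x))
  have hsplit : ∑ x, ((1 - t) * s x + t * q x) * Real.log (((1 - t) * s x + t * q x) / p x) =
      (1 - t) * ∑ x, s x * Real.log (((1 - t) * s x + t * q x) / p x) +
        t * ∑ x, q x * Real.log (((1 - t) * s x + t * q x) / p x) := by
    rw [Finset.mul_sum, Finset.mul_sum, ← Finset.sum_add_distrib]
    exact Finset.sum_congr rfl fun x _ => by ring
  rw [hsplit] at hmin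
  have h := mul_le_mul_of_nonneg_left hgibbs ht1'.le
  exact le_of_mul_le_mul_left (by linarith) ht0

theorem IsPMF.le_one {X : Type*} [Fintype X] {p : X → ℝ} (hp : IsPMF p) (x : X) : p x ≤ 1 :=
  hp.2 ▸ Finset.single_le_sum (fun y _ => hp.1 y) (Finset.mem_univ x)

/-- If the `q`-average log-density along the segment from `s` to `q` is bounded below, then
the support of `q` is contained in the support of `s`. -/
theorem pos_of_forall_le_sum_mul_log_segment {X : Type*} [Fintype X] {p q s : X → ℝ}
    (hp : ∀ x, 0 < p x) (hq : IsPMF q) (hs : IsPMF s) {B : ℝ}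
    (hB : ∀ t : ℝ, 0 < t → t < 1 →
      B ≤ ∑ x, q x * Real.log (((1 - t) * s x + t * q x) / p x))
    {a : X} (ha : 0 < q a) : 0 < s a := by
  classical
  by_contra hsa
  have hsa0 : s a = 0 := le_antisymm (not_lt.1 hsa) (hs.1 a)
  have hbound : ∀ t : ℝ, 0 < t → t < 1 →
      B ≤ q a * Real.log t + (q a * Real.log (q a) - ∑ x, q x * Real.log (p x)) := by
    intro t ht0 ht1
    have hterm : ∀ x, q x * Real.log (((1 - t) * s x + t * q x) / p x) ≤
        (if x = a then q a * Real.log t + q a * Real.log (q a) else 0)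
          - q x * Real.log (p x) := by
      intro x
      by_cases hxa : x = a
      · subst hxa
        rw [if_pos rfl, hsa0, mul_zero, zero_add, Real.log_div (mul_pos ht0 ha).ne' (hp x).ne',
          Real.log_mul ht0.ne' ha.ne']
        exact le_of_eq (by ring)
      · rw [if_neg hxa]
        rcases (hq.1 x).eq_or_lt with h | h
        · simp [← h]
        · have hpos : 0 < (1 - t) * s x + t * q x :=
            add_pos_of_nonneg_of_pos (mul_nonneg (sub_pos.2 ht1).le (hs.1 x)) (mul_pos ht0 h)
          have hle : (1 - t) * s x + t * q x ≤ 1 := by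
            have h1 := mul_le_mul_of_nonneg_left (hs.le_one x) (sub_pos.2 ht1).le
            have h2 := mul_le_mul_of_nonneg_left (hq.le_one x) ht0.le
            linarith
          rw [Real.log_div hpos.ne' (hp x).ne']
          have h3 := mul_nonpos_of_nonneg_of_nonpos h.le (Real.log_nonpos hpos.le hle)
          linarith
    have hsum := (hB t ht0 ht1).trans (Finset.sum_le_sum fun x _ => hterm x)
    rw [Finset.sum_sub_distrib, Finset.sum_ite_eq' Finset.univ a, if_pos (Finset.mem_univ a)]
      at hsum
    linarith
  set K := q a * Real.log (q a) - ∑ x, q x * Real.log (p x)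
  have hM : 0 < (|K - B| + 1) / q a := by positivity
  have h := hbound (Real.exp (-((|K - B| + 1) / q a))) (Real.exp_pos _)
    (Real.exp_lt_one_iff.2 (neg_lt_zero.2 hM))
  rw [Real.log_exp, mul_neg, mul_div_cancel₀ _ ha.ne'] at h
  linarith [le_abs_self (K - B)]

/-- Pythagorean inequality for the entropic projection: if `q*` minimises `KL(·‖p)` over a
nonempty closed convex subset `C` of the simplex and `KL(q*‖p)` is finite, then for every
`q ∈ C` one has `KL(q‖p) ≥ KL(q‖q*) + KL(q*‖p)`. -/
theorem KL_projection_pythagorean_inequality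
    (X : Type*) [Fintype X] [Nonempty X]
    (p : X → ℝ) (hp : IsPMF p) (hppos : ∀ x, 0 < p x)
    (C : Set (X → ℝ)) (hCne : C.Nonempty) (hCclosed : IsClosed C)
    (hCconv : Convex ℝ C) (hCsub : C ⊆ {r : X → ℝ | IsPMF r})
    (qstar : X → ℝ) (hqstarC : qstar ∈ C)
    (hmin : ∀ q ∈ C, KL qstar p ≤ KL q p)
    (hfin : KL qstar p ≠ ⊤) :
    ∀ q ∈ C, KL q qstar + KL qstar p ≤ KL q p := by
  intro q hqC
  have hq : IsPMF q := hCsub hqC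
  have hs : IsPMF qstar := hCsub hqstarC
  have hB : ∀ t : ℝ, 0 < t → t < 1 → ∑ x, qstar x * Real.log (qstar x / p x) ≤
      ∑ x, q x * Real.log (((1 - t) * qstar x + t * q x) / p x) := by
    intro t ht0 ht1
    refine sum_mul_log_div_le_of_le_segment hppos hq hs ht0 ht1 ?_
    have h := hmin _ (hCconv hqstarC hqC (sub_pos.2 ht1).le ht0.le (sub_add_cancel 1 t))
    rw [KL_eq_coe_of_pos hppos, KL_eq_coe_of_pos hppos, EReal.coe_le_coe_iff] at h
    simpa only [Pi.add_apply, Pi.smul_apply, smul_eq_mul] using h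
  have hsupp : ∀ x, 0 < q x → 0 < qstar x := fun x hx =>
    pos_of_forall_le_sum_mul_log_segment hppos hq hs hB hx
  have hlim : Filter.Tendsto
      (fun t : ℝ => ∑ x, q x * Real.log (((1 - t) * qstar x + t * q x) / p x))
      (nhdsWithin 0 (Set.Ioi 0)) (nhds (∑ x, q x * Real.log (qstar x / p x))) := by
    refine tendsto_finsetSum _ fun x _ => ?_
    rcases (hq.1 x).eq_or_lt with h | h
    · simp [← h]
    · have hne : qstar x / p x ≠ 0 := (div_pos (hsupp x h) (hppos x)).ne'
      have hc : Filter.Tendsto (fun t : ℝ => ((1 - t) * qstar x + t * q x) / p x)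
          (nhds 0) (nhds (qstar x / p x)) := by
        have hcont : Continuous fun t : ℝ => ((1 - t) * qstar x + t * q x) / p x := by fun_prop
        simpa using hcont.tendsto 0
      exact ((hc.log hne).const_mul (q x)).mono_left nhdsWithin_le_nhds
  have hfirst : ∑ x, qstar x * Real.log (qstar x / p x) ≤
      ∑ x, q x * Real.log (qstar x / p x) := by
    refine ge_of_tendsto hlim ?_
    filter_upwards [Ioo_mem_nhdsGT (zero_lt_one (α := ℝ))] with t ht using hB t ht.1 ht.2
  have hchain : ∑ x, q x * Real.log (q x / p x) =
      ∑ x, q x * Real.log (q x / qstar x) + ∑ x, q x * Real.log (qstar x / p x) := by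
    rw [← Finset.sum_add_distrib]
    refine Finset.sum_congr rfl fun x _ => ?_
    rcases (hq.1 x).eq_or_lt with h | h
    · simp [← h]
    · have hsx := hsupp x h
      rw [Real.log_div h.ne' (hppos x).ne', Real.log_div h.ne' hsx.ne',
        Real.log_div hsx.ne' (hppos x).ne']
      ring
  rw [KL_eq_coe_of_pos hppos, KL_eq_coe_of_pos hppos, KL, if_pos hsupp, ← EReal.coe_add,
    EReal.coe_le_coe_iff, hchain]
  exact add_le_add_right hfirst _
end

section
/- Let X be a finite nonempty type and let t ↦ p_t be a curve of probability mass functions on X, defined for t in an open interval around 0, such that p_t(x) > 0 for all t and x, and such that for each x the map t ↦ p_t(x) is twice continuously differentiable. Define f(t) := KL(p₀‖p_t) = Σ_x p₀(x)·log(p₀(x)/p_t(x)). Then f(0) = 0, f'(0) = 0, and f''(0) = Σ_x (d/dt p_t(x)|_{t=0})² / p₀(x), i.e. the second-order Taylor coefficient of the Kullback–Leibler relative entropy along the curve is the Fisher–Rao information Σ_x p₀(x)·(d/dt log p_t(x)|_{t=0})². -/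
open scoped BigOperators

open Topology

/-- If finitely many differentiable functions have a locally constant sum, then their derivatives
sum to zero. -/
theorem sum_deriv_eq_zero_of_sum_eventuallyEq_const {X : Type*} [Fintype X] {g : X → ℝ → ℝ}
    {t c : ℝ} (hg : ∀ x, DifferentiableAt ℝ (g x) t)
    (hc : (fun s => ∑ x, g x s) =ᶠ[𝓝 t] fun _ => c) :
    ∑ x, deriv (g x) t = 0 := by
  have h := (HasDerivAt.fun_sum fun x (_ : x ∈ Finset.univ) => (hg x).hasDerivAt).deriv
  rw [← h, hc.deriv_eq, deriv_const]

/-- The derivative of `t ↦ c * log (c / q t)` is `-(c * (q' / q t))`. -/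
theorem HasDerivAt.const_mul_log_const_div {q : ℝ → ℝ} {c t q' : ℝ} (hc : c ≠ 0) (hq : q t ≠ 0)
    (h : HasDerivAt q q' t) :
    HasDerivAt (fun s => c * Real.log (c / q s)) (-(c * (q' / q t))) t := by
  refine ((((hasDerivAt_const t c).fun_div h hq).log (div_ne_zero hc hq)).const_mul c).congr_deriv ?_
  field_simp
  ring

/-- Second-order Taylor expansion of the Kullback–Leibler relative entropy along a smooth
curve of everywhere-positive probability mass functions: `f(t) := KL(p₀‖p_t)` satisfies
`f 0 = 0`, `f' 0 = 0`, and `f'' 0` is the Fisher–Rao information. -/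
theorem KL_second_order_taylor_is_fisher_rao
    (X : Type*) [Fintype X] [Nonempty X]
    (a b : ℝ) (ha : a < 0) (hb : 0 < b)
    (p : ℝ → X → ℝ)
    (hpmf : ∀ t ∈ Set.Ioo a b, IsPMF (p t))
    (hpos : ∀ t ∈ Set.Ioo a b, ∀ x, 0 < p t x)
    (hsmooth : ∀ x, ContDiffOn ℝ 2 (fun t => p t x) (Set.Ioo a b))
    (f : ℝ → ℝ)
    (hf : f = fun t => ∑ x, p 0 x * Real.log (p 0 x / p t x)) :
    f 0 = 0 ∧ deriv f 0 = 0 ∧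
      deriv (deriv f) 0 = ∑ x, (deriv (fun t => p t x) 0) ^ 2 / p 0 x ∧
      deriv (deriv f) 0 = ∑ x, p 0 x * (deriv (fun t => Real.log (p t x)) 0) ^ 2 := by
  have h0 : (0 : ℝ) ∈ Set.Ioo a b := ⟨ha, hb⟩
  have hnhds : ∀ t ∈ Set.Ioo a b, Set.Ioo a b ∈ 𝓝 t := fun t ht => Ioo_mem_nhds ht.1 ht.2
  have hdiff : ∀ t ∈ Set.Ioo a b, ∀ x, DifferentiableAt ℝ (fun t => p t x) t := fun t ht x =>
    ((hsmooth x).contDiffAt (hnhds t ht)).differentiableAt (by norm_num)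
  have hdiff' : ∀ x, DifferentiableAt ℝ (deriv fun t => p t x) 0 := fun x =>
    ((contDiffOn_succ_iff_deriv_of_isOpen (n := 1) isOpen_Ioo).1 (hsmooth x)).2.2.differentiableOn
      one_ne_zero |>.differentiableAt (hnhds 0 h0)
  have hp0 : ∀ x, p 0 x ≠ 0 := fun x => (hpos 0 h0 x).ne'
  have hsum : ∀ t ∈ Set.Ioo a b, ∑ x, deriv (fun t => p t x) t = 0 := fun t ht =>
    sum_deriv_eq_zero_of_sum_eventuallyEq_const (c := 1) (hdiff t ht)
      (by filter_upwards [hnhds t ht] with s hs using (hpmf s hs).2)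
  have hsum' : ∑ x, deriv (deriv fun t => p t x) 0 = 0 :=
    sum_deriv_eq_zero_of_sum_eventuallyEq_const (c := 0) hdiff'
      (by filter_upwards [hnhds 0 h0] with s hs using hsum s hs)
  have hderiv : ∀ t ∈ Set.Ioo a b,
      deriv f t = ∑ x, -(p 0 x * (deriv (fun t => p t x) t / p t x)) := by
    intro t ht
    rw [hf]
    exact (HasDerivAt.fun_sum fun x _ =>
      (hdiff t ht x).hasDerivAt.const_mul_log_const_div (hp0 x) (hpos t ht x).ne').deriv
  have hderiv2 : deriv (deriv f) 0 = ∑ x, (deriv (fun t => p t x) 0) ^ 2 / p 0 x := by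
    have heq : deriv f =ᶠ[𝓝 0]
        fun t => ∑ x, -(p 0 x * (deriv (fun t => p t x) t / p t x)) := by
      filter_upwards [hnhds 0 h0] with t ht using hderiv t ht
    rw [heq.deriv_eq, (HasDerivAt.fun_sum fun x _ => (((hdiff' x).hasDerivAt.fun_div
      (hdiff 0 h0 x).hasDerivAt (hp0 x)).const_mul (p 0 x)).fun_neg).deriv,
      ← sub_eq_zero, ← Finset.sum_sub_distrib, ← neg_eq_zero, ← Finset.sum_neg_distrib]
    refine (Finset.sum_congr rfl fun x _ => ?_).trans hsum'
    have := hp0 x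
    field_simp
    ring
  refine ⟨?_, ?_, hderiv2, ?_⟩
  · simp [hf, hp0]
  · rw [hderiv 0 h0, Finset.sum_neg_distrib, neg_eq_zero]
    exact (Finset.sum_congr rfl fun x _ => mul_div_cancel₀ _ (hp0 x)).trans (hsum 0 h0)
  · rw [hderiv2]
    refine Finset.sum_congr rfl fun x _ => ?_
    rw [((hdiff 0 h0 x).hasDerivAt.log (hp0 x)).deriv]
    have := hp0 x
    field_simp
end
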